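/- Let G be a connected graph of order n with 12 ≤ n. If λ₁(D(G)) ≤ λ₁(D(G*)), where G* = K₁ ∨ (K_{n-5} ∪ 4K₁), then G admits a spanning 4-tree, unless G is isomorphic to G*. -/

import Mathlib

/-- The disjoint union `G ∪ H` of two simple graphs (on the sum of the vertex types). -/
def graphDisjUnion {α β : Type*} (G : SimpleGraph α) (H : SimpleGraph β) :
    SimpleGraph (α ⊕ β) :=
  SimpleGraph.fromRel (Sum.LiftRel G.Adj H.Adj)

/-- The join `G ∨ H` of two simple graphs: the disjoint union together with all edges
between the two parts. -/
def graphJoin {α β : Type*} (G : SimpleGraph α) (H : SimpleGraph β) :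
    SimpleGraph (α ⊕ β) :=
  SimpleGraph.fromRel (fun u v => Sum.LiftRel G.Adj H.Adj u v ∨ (u.isLeft ∧ v.isRight))

/-- The distance matrix of a graph: the `(u,v)` entry is the graph distance `d_G(u,v)`. -/
noncomputable def distMatrix {V : Type*} [Fintype V] (G : SimpleGraph V) :
    Matrix V V ℝ :=
  Matrix.of fun u v => (G.dist u v : ℝ)

/-- The distance spectral radius `λ₁(D(G))`: the largest eigenvalue of the distance
matrix of `G` (for a connected graph the distance matrix is symmetric nonnegative, so this
is the largest element of its real spectrum). -/
noncomputable def distSpecRad {V : Type*} [Fintype V] [DecidableEq V]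
    (G : SimpleGraph V) : ℝ :=
  sSup (spectrum ℝ (distMatrix G))

/-- `G` has a spanning `k`-tree: a spanning subgraph which is a tree of maximum degree
at most `k`. -/
def HasSpanningKTree {V : Type*} [Fintype V] (G : SimpleGraph V) (k : ℕ) : Prop :=
  ∃ T : SimpleGraph V, T ≤ G ∧ T.IsTree ∧ ∀ v : V, (T.neighborSet v).ncard ≤ k

/-- The Wiener index `W(G) = ∑_{i<j} d_G(v_i, v_j)`, written as half of the full double
sum of distances. -/
noncomputable def wiener {V : Type*} [Fintype V] (G : SimpleGraph V) : ℝ :=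
  (∑ u : V, ∑ v : V, (G.dist u v : ℝ)) / 2

/-- The graph `G* = K₁ ∨ (K_{n-k-1} ∪ kK₁)`. -/
def starGraph (n k : ℕ) : SimpleGraph (Fin 1 ⊕ (Fin (n - k - 1) ⊕ Fin k)) :=
  graphJoin (⊤ : SimpleGraph (Fin 1))
    (graphDisjUnion (⊤ : SimpleGraph (Fin (n - k - 1))) (⊥ : SimpleGraph (Fin k)))

/-- The graph `G♯ = K_{(n-3)/3} ∨ ((2n+3)/3)K₁`. -/
def sharpGraph (n : ℕ) : SimpleGraph (Fin ((n - 3) / 3) ⊕ Fin ((2 * n + 3) / 3)) :=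
  graphJoin (⊤ : SimpleGraph (Fin ((n - 3) / 3))) (⊥ : SimpleGraph (Fin ((2 * n + 3) / 3)))

/-- The graph `G̃ = K_s ∨ (K_{n-(k-1)s-2} ∪ ((k-2)s+2)K₁)`. -/
def tildeGraph (n k s : ℕ) :
    SimpleGraph (Fin s ⊕ (Fin (n - (k - 1) * s - 2) ⊕ Fin ((k - 2) * s + 2))) :=
  graphJoin (⊤ : SimpleGraph (Fin s))
    (graphDisjUnion (⊤ : SimpleGraph (Fin (n - (k - 1) * s - 2)))
      (⊥ : SimpleGraph (Fin ((k - 2) * s + 2))))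

/-- The graph `G' = K_s ∨ (K_{n-s-(t-1)} ∪ (t-1)K₁)`. -/
def primeGraph (n s t : ℕ) :
    SimpleGraph (Fin s ⊕ (Fin (n - s - (t - 1)) ⊕ Fin (t - 1))) :=
  graphJoin (⊤ : SimpleGraph (Fin s))
    (graphDisjUnion (⊤ : SimpleGraph (Fin (n - s - (t - 1)))) (⊥ : SimpleGraph (Fin (t - 1))))

/-- The graph on the vertices of `H` whose edges are those of `H` with both ends in `C`. -/
def SimpleGraph.inside {V : Type*} (H : SimpleGraph V) (C : Set V) : SimpleGraph V where
  Adj a b := H.Adj a b ∧ a ∈ C ∧ b ∈ C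
  symm := ⟨fun _ _ h => ⟨h.1.symm, h.2.2, h.2.1⟩⟩
  loopless := ⟨fun _ h => h.1.ne rfl⟩

/-- `H` arises from `T` by replacing edges inside `C` without destroying connections. -/
structure SimpleGraph.IsRewiring {V : Type*} (C : Set V) (T H : SimpleGraph V) : Prop where
  agree : ∀ a b, ¬(a ∈ C ∧ b ∈ C) → (H.Adj a b ↔ T.Adj a b)
  reach : ∀ a b, T.Adj a b → a ∈ C → b ∈ C → (H.inside C).Reachable a b

/-- The vertices that can be reached from `u` in `T` while avoiding `M`. -/
def SimpleGraph.compAvoiding {V : Type*} (T : SimpleGraph V) (M : Set V) (u : V) : Set V :=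
  {x | (T.inside Mᶜ).Reachable u x}

namespace SimpleGraph

variable {V : Type*}

theorem Reachable.of_forall_adj {G H : SimpleGraph V}
    (h : ∀ a b, G.Adj a b → H.Reachable a b) {x y : V} (hxy : G.Reachable x y) :
    H.Reachable x y := by
  obtain ⟨p⟩ := hxy
  induction p with
  | nil => exact Reachable.refl _
  | cons hadj _ ih => exact (h _ _ hadj).trans ih

theorem inside_mono {G H : SimpleGraph V} {C D : Set V} (hCD : C ⊆ D)
    (h : ∀ a b, a ∈ C → b ∈ C → G.Adj a b → H.Adj a b) : G.inside C ≤ H.inside D :=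
  fun _ _ hab => ⟨h _ _ hab.2.1 hab.2.2 hab.1, hCD hab.2.1, hCD hab.2.2⟩

theorem mem_compAvoiding_self (T : SimpleGraph V) (M : Set V) (u : V) :
    u ∈ T.compAvoiding M u := Reachable.refl u

theorem compAvoiding_subset_compl (T : SimpleGraph V) {M : Set V} {u : V} (hu : u ∉ M) :
    T.compAvoiding M u ⊆ Mᶜ := by
  rintro x ⟨p⟩
  induction p with
  | nil => exact hu
  | cons h _ ih => exact ih h.2.2

theorem compAvoiding_anti (T : SimpleGraph V) {M N : Set V} (h : N ⊆ M) (u : V) :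
    T.compAvoiding M u ⊆ T.compAvoiding N u := fun _ hx =>
  Reachable.mono (inside_mono (Set.compl_subset_compl.2 h) fun _ _ _ _ h => h) hx

theorem disjoint_compAvoiding (T : SimpleGraph V) {M : Set V} {u v : V}
    (h : ¬(T.inside Mᶜ).Reachable u v) :
    Disjoint (T.compAvoiding M u) (T.compAvoiding M v) :=
  Set.disjoint_left.2 fun _ hx hy => h (Reachable.trans hx (Reachable.symm hy))

theorem Walk.mem_compAvoiding {T : SimpleGraph V} {M : Set V} {u v : V} (p : T.Walk u v)
    (hp : ∀ y ∈ p.support, y ∉ M) : ∀ y ∈ p.support, y ∈ T.compAvoiding M u := by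
  induction p with
  | nil => intro y hy; simp at hy; subst hy; exact mem_compAvoiding_self _ _ _
  | @cons a b c h p ih =>
    intro y hy
    rw [Walk.support_cons, List.mem_cons] at hy
    rcases hy with rfl | hy
    · exact mem_compAvoiding_self _ _ _
    · have hb := ih (fun z hz => hp z (by simp [hz])) y hy
      have : (T.inside Mᶜ).Adj a b :=
        ⟨h, hp a (by simp), hp b (by simp)⟩
      exact this.reachable.trans hb

theorem IsRewiring.refl (C : Set V) (T : SimpleGraph V) : IsRewiring C T T :=
  ⟨fun _ _ _ => Iff.rfl, fun _ _ h ha hb => Adj.reachable ⟨h, ha, hb⟩⟩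

theorem IsRewiring.mono {C D : Set V} {T H : SimpleGraph V} (h : IsRewiring C T H)
    (hCD : C ⊆ D) : IsRewiring D T H := by
  refine ⟨fun a b hab => h.agree a b fun h' => hab ⟨hCD h'.1, hCD h'.2⟩, fun a b hab ha hb => ?_⟩
  by_cases hc : a ∈ C ∧ b ∈ C
  · exact (h.reach a b hab hc.1 hc.2).mono (inside_mono hCD fun _ _ _ _ h => h)
  · exact Adj.reachable ⟨(h.agree a b hc).2 hab, ha, hb⟩

theorem IsRewiring.connected {C : Set V} {T H : SimpleGraph V} (h : IsRewiring C T H)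
    (hT : T.Connected) : H.Connected := by
  have := hT.nonempty
  refine ⟨fun x y => (hT.preconnected x y).of_forall_adj fun a b hab => ?_⟩
  exact ((h.mono (Set.subset_univ C)).reach a b hab trivial trivial).of_forall_adj
    fun a b (h : (H.inside Set.univ).Adj a b) => h.1.reachable

theorem IsRewiring.neighborSet_eq {C : Set V} {T H : SimpleGraph V} (h : IsRewiring C T H)
    {y : V} (hy : y ∉ C) : H.neighborSet y = T.neighborSet y := by
  ext z
  exact h.agree y z fun h' => hy h'.1

/-- Two rewirings in disjoint sets can be performed simultaneously. -/
theorem IsRewiring.exists_union {C D : Set V} {T H K : SimpleGraph V} (hH : IsRewiring C T H)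
    (hK : IsRewiring D T K) (hCD : Disjoint C D) :
    ∃ L, IsRewiring (C ∪ D) T L ∧ L ≤ H ⊔ K ∧
      (∀ y ∈ C, L.neighborSet y = H.neighborSet y) ∧
      (∀ y ∈ D, L.neighborSet y = K.neighborSet y) := by
  rw [Set.disjoint_left] at hCD
  have hDC : ∀ a b, a ∈ D → (a ∈ C ∨ b ∈ C) → (H.Adj a b ↔ K.Adj a b) := fun a b ha hb => by
    have h1 : a ∉ C := fun h => hCD h ha
    have h2 : b ∉ D := fun h => hCD (hb.resolve_left h1) h
    rw [hH.agree a b fun h => h1 h.1, hK.agree a b fun h => h2 h.2]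
  let L : SimpleGraph V :=
    { Adj := fun a b => ((a ∈ C ∨ b ∈ C) ∧ H.Adj a b) ∨ (¬(a ∈ C ∨ b ∈ C) ∧ K.Adj a b)
      symm := ⟨fun a b h => by
        rw [H.adj_comm b a, K.adj_comm b a, or_comm (a := b ∈ C)]; exact h⟩
      loopless := ⟨fun a h => by simp at h⟩ }
  have hL : ∀ a b, L.Adj a b ↔
      ((a ∈ C ∨ b ∈ C) ∧ H.Adj a b) ∨ (¬(a ∈ C ∨ b ∈ C) ∧ K.Adj a b) := fun _ _ => Iff.rfl
  refine ⟨L, ⟨fun a b hab => ?_, fun a b hab ha hb => ?_⟩, fun a b h => ?_, fun y hy => ?_,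
    fun y hy => ?_⟩
  · rw [hL]
    have h1 := hH.agree a b fun h => hab ⟨Or.inl h.1, Or.inl h.2⟩
    have h2 := hK.agree a b fun h => hab ⟨Or.inr h.1, Or.inr h.2⟩
    tauto
  · by_cases h1 : a ∈ C ∧ b ∈ C
    · exact (hH.reach a b hab h1.1 h1.2).mono (inside_mono Set.subset_union_left
        fun x y hx _ h => Or.inl ⟨Or.inl hx, h⟩)
    · by_cases h2 : a ∈ D ∧ b ∈ D
      · exact (hK.reach a b hab h2.1 h2.2).mono (inside_mono Set.subset_union_right
          fun x y hx hy h => Or.inr ⟨fun h => h.elim (hCD · hx) (hCD · hy), h⟩)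
      · refine Adj.reachable ⟨?_, ha, hb⟩
        rw [hL, hH.agree a b h1, hK.agree a b h2]
        tauto
  · rcases h with h | h
    · exact Or.inl h.2
    · exact Or.inr h.2
  · ext z
    simp only [mem_neighborSet, hL]
    tauto
  · ext z
    have := hDC y z hy
    simp only [mem_neighborSet, hL]
    tauto

/-- Adding the edge `uv` and removing an edge of a path from `u` to `v`, after a rewiring which
does not touch the removed edge. -/
theorem IsRewiring.swap {C D : Set V} {T K : SimpleGraph V} (hK : IsRewiring D T K) (hDC : D ⊆ C)
    {u v : V} {p : T.Walk u v} (hp : p.IsPath) (hs : ∀ y ∈ p.support, y ∈ C)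
    (huv : ¬T.Adj u v) (hne : u ≠ v) {x z : V} (he : s(x, z) ∈ p.edges) (hx : x ∉ D) :
    IsRewiring C T (K.deleteEdges {s(x, z)} ⊔ edge u v) := by
  have hxC := hs x (p.fst_mem_support_of_mem_edges he)
  have hzC := hs z (p.snd_mem_support_of_mem_edges he)
  have huC := hs u p.start_mem_support
  have hvC := hs v p.end_mem_support
  have hcyc : ((T.inside C ⊔ edge v u).deleteEdges {s(x, z)}).Reachable x z := by
    refine (adj_and_reachable_delete_edges_iff_exists_cycle.2 ?_).2
    have hpe : ∀ e ∈ p.edges, e ∈ (T.inside C ⊔ edge v u).edgeSet := by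
      intro e he
      induction e with
      | h a b =>
        exact Or.inl ⟨p.adj_of_mem_edges he, hs a (p.fst_mem_support_of_mem_edges he),
          hs b (p.snd_mem_support_of_mem_edges he)⟩
    refine ⟨v, Walk.cons (Or.inr ((edge_adj _ _ _ _).2 ⟨Or.inl ⟨rfl, rfl⟩, hne.symm⟩))
      (p.transfer _ hpe), ?_, ?_⟩
    · rw [Walk.cons_isCycle_iff]
      refine ⟨hp.transfer hpe, ?_⟩
      rw [Walk.edges_transfer, Sym2.eq_swap]
      exact fun h => huv (p.adj_of_mem_edges h)
    · simp [he]
  have hreach : ∀ a b, T.Adj a b → a ∈ C → b ∈ C → s(a, b) ≠ s(x, z) →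
      ((K.deleteEdges {s(x, z)} ⊔ edge u v).inside C).Reachable a b := by
    intro a b hab ha hb hne'
    by_cases hd : a ∈ D ∧ b ∈ D
    · refine (hK.reach a b hab hd.1 hd.2).mono (inside_mono hDC fun r s hr hs' h => Or.inl ?_)
      rw [deleteEdges_adj]
      refine ⟨h, fun h' => ?_⟩
      rw [Set.mem_singleton_iff, Sym2.eq_iff] at h'
      rcases h' with ⟨rfl, rfl⟩ | ⟨rfl, rfl⟩
      · exact hx hr
      · exact hx hs'
    · refine Adj.reachable ⟨Or.inl ?_, ha, hb⟩
      rw [deleteEdges_adj]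
      exact ⟨(hK.agree a b hd).2 hab, hne'⟩
  have hxz : ((K.deleteEdges {s(x, z)} ⊔ edge u v).inside C).Reachable x z := by
    refine hcyc.of_forall_adj fun a b hab => ?_
    rw [deleteEdges_adj] at hab
    rcases hab with ⟨hab | hab, hne'⟩
    · exact hreach a b hab.1 hab.2.1 hab.2.2 hne'
    · rw [edge_comm] at hab
      refine Adj.reachable ⟨Or.inr hab, ?_⟩
      rw [edge_adj] at hab
      rcases hab.1 with ⟨rfl, rfl⟩ | ⟨rfl, rfl⟩ <;> exact ⟨by assumption, by assumption⟩
  refine ⟨fun a b hab => ?_, fun a b hab ha hb => ?_⟩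
  · have h1 := hK.agree a b fun h => hab ⟨hDC h.1, hDC h.2⟩
    have h2 : s(a, b) ≠ s(x, z) := by
      intro h
      rw [Sym2.eq_iff] at h
      rcases h with ⟨rfl, rfl⟩ | ⟨rfl, rfl⟩
      · exact hab ⟨hxC, hzC⟩
      · exact hab ⟨hzC, hxC⟩
    have h3 : ¬(edge u v).Adj a b := by
      rw [edge_adj]
      rintro ⟨⟨rfl, rfl⟩ | ⟨rfl, rfl⟩, -⟩
      · exact hab ⟨huC, hvC⟩
      · exact hab ⟨hvC, huC⟩
    rw [sup_adj, deleteEdges_adj, h1, Set.mem_singleton_iff]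
    tauto
  · by_cases hab' : s(a, b) = s(x, z)
    · rw [Sym2.eq_iff] at hab'
      rcases hab' with ⟨rfl, rfl⟩ | ⟨rfl, rfl⟩
      · exact hxz
      · exact hxz.symm
    · exact hreach a b hab ha hb hab'

/-- `H` is a rewiring of `T` in `C` by edges of `G` which creates no new excess over degree
`k`. -/
structure IsControlledRewiring (G : SimpleGraph V) (k : ℕ) (C : Set V) (T H : SimpleGraph V) :
    Prop extends IsRewiring C T H where
  le : H ≤ G
  excess_le : ∀ y, (H.neighborSet y).ncard - k ≤ (T.neighborSet y).ncard - k

theorem IsControlledRewiring.exists_swap [Finite V] {G T : SimpleGraph V} {k : ℕ}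
    {M C : Set V} {u v : V} (hu : u ∉ M) (hv : v ∉ M) (hG : G.Adj u v)
    (hnr : ¬(T.inside Mᶜ).Reachable u v) {H K : SimpleGraph V}
    (hH : IsControlledRewiring G k (T.compAvoiding M u) T H)
    (hHu : (H.neighborSet u).ncard < k)
    (hK : IsControlledRewiring G k (T.compAvoiding M v) T K)
    (hKv : (K.neighborSet v).ncard < k)
    {p : T.Walk u v} (hp : p.IsPath) (hs : ∀ y ∈ p.support, y ∈ C)
    (hCu : T.compAvoiding M u ⊆ C) (hCv : T.compAvoiding M v ⊆ C)
    {x : V} (hxp : x ∈ p.support) (hxM : x ∈ M) :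
    ∃ L, IsControlledRewiring G k C T L ∧
      (L.neighborSet x).ncard < (T.neighborSet x).ncard := by
  have hxu : x ≠ u := fun h => hu (h ▸ hxM)
  have hxv : x ≠ v := fun h => hv (h ▸ hxM)
  have huv : ¬T.Adj u v := fun h => hnr (Adj.reachable ⟨h, hu, hv⟩)
  obtain ⟨L, hL, hLle, hLu, hLv⟩ :=
    hH.toIsRewiring.exists_union hK.toIsRewiring (T.disjoint_compAvoiding hnr)
  have hxD : x ∉ T.compAvoiding M u ∪ T.compAvoiding M v := fun h => h.elim
    (fun h => T.compAvoiding_subset_compl hu h hxM) (fun h => T.compAvoiding_subset_compl hv h hxM)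
  have hnotnil : ¬p.Nil := fun h => hG.ne h.eq
  obtain ⟨e, he, hxe⟩ := (Walk.mem_support_iff_exists_mem_edges_of_not_nil hnotnil).1 hxp
  obtain ⟨z, rfl⟩ := Sym2.mem_iff_exists.1 hxe
  have hexL : ∀ y, (L.neighborSet y).ncard - k ≤ (T.neighborSet y).ncard - k := by
    intro y
    by_cases h1 : y ∈ T.compAvoiding M u
    · rw [hLu y h1]; exact hH.excess_le y
    by_cases h2 : y ∈ T.compAvoiding M v
    · rw [hLv y h2]; exact hK.excess_le y
    rw [hL.neighborSet_eq fun h => h.elim h1 h2]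
  have hLu' : (L.neighborSet u).ncard < k := by
    rwa [hLu u (T.mem_compAvoiding_self M u)]
  have hLv' : (L.neighborSet v).ncard < k := by
    rwa [hLv v (T.mem_compAvoiding_self M v)]
  refine ⟨_, ⟨hL.swap (Set.union_subset hCu hCv) hp hs huv hG.ne he hxD, ?_, ?_⟩, ?_⟩
  · refine sup_le ((deleteEdges_le _).trans (hLle.trans (sup_le hH.le hK.le))) ?_
    intro a b hab
    rw [edge_adj] at hab
    rcases hab.1 with ⟨rfl, rfl⟩ | ⟨rfl, rfl⟩
    · exact hG
    · exact hG.symm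
  · intro y
    by_cases hyu : y = u
    · subst hyu
      have : (L.deleteEdges {s(x, z)} ⊔ edge y v).neighborSet y ⊆ insert v (L.neighborSet y) := by
        intro b hb
        simp only [mem_neighborSet, sup_adj, deleteEdges_adj, edge_adj] at hb
        simp only [Set.mem_insert_iff, mem_neighborSet]
        tauto
      have := Set.ncard_le_ncard this
      have := Set.ncard_insert_le v (L.neighborSet y)
      omega
    by_cases hyv : y = v
    · subst hyv
      have : (L.deleteEdges {s(x, z)} ⊔ edge u y).neighborSet y ⊆ insert u (L.neighborSet y) := by
        intro b hb
        simp only [mem_neighborSet, sup_adj, deleteEdges_adj, edge_adj] at hb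
        simp only [Set.mem_insert_iff, mem_neighborSet]
        tauto
      have := Set.ncard_le_ncard this
      have := Set.ncard_insert_le u (L.neighborSet y)
      omega
    · have : (L.deleteEdges {s(x, z)} ⊔ edge u v).neighborSet y ⊆ L.neighborSet y := by
        intro b hb
        simp only [mem_neighborSet, sup_adj, deleteEdges_adj, edge_adj] at hb ⊢
        tauto
      have := Set.ncard_le_ncard this
      have := hexL y
      omega
  · rw [← hL.neighborSet_eq hxD]
    refine Set.ncard_lt_ncard ⟨?_, fun h => ?_⟩
    · intro b hb
      simp only [mem_neighborSet, sup_adj, deleteEdges_adj, edge_adj] at hb ⊢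
      tauto
    · have hz : z ∈ L.neighborSet x :=
        (hL.agree x z fun h => hxD h.1).2 (p.adj_of_mem_edges he)
      have := h hz
      simp only [mem_neighborSet, sup_adj, deleteEdges_adj, edge_adj] at this
      simp_all

/-- If a connected spanning subgraph `T` has least total excess over degree `k`, then some set `M`
of vertices of degree at least `k`, containing all vertices of degree more than `k`, cuts `T` and
`G` in the same way. -/
theorem exists_barrier [Fintype V] {G T : SimpleGraph V} {k : ℕ} (hTG : T ≤ G)
    (hT : T.Connected)
    (hmin : ∀ H ≤ G, H.Connected → ∑ y, ((T.neighborSet y).ncard - k) ≤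
      ∑ y, ((H.neighborSet y).ncard - k)) :
    ∃ M : Set V, (∀ w, k < (T.neighborSet w).ncard → w ∈ M) ∧
      (∀ w ∈ M, k ≤ (T.neighborSet w).ncard) ∧
      ∀ u v, u ∉ M → v ∉ M → G.Adj u v → (T.inside Mᶜ).Reachable u v := by
  classical
  let P : Set V → Prop := fun M => (∀ w, k < (T.neighborSet w).ncard → w ∈ M) ∧
      (∀ w ∈ M, k ≤ (T.neighborSet w).ncard) ∧
      ∀ u ∉ M, ∃ H, IsControlledRewiring G k (T.compAvoiding M u) T H ∧
        (H.neighborSet u).ncard < k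
  have hP0 : P {w | k ≤ (T.neighborSet w).ncard} := by
    refine ⟨fun w hw => hw.le, fun w hw => hw,
      fun u hu => ⟨T, ⟨.refl _ _, hTG, fun _ => le_rfl⟩, ?_⟩⟩
    simpa using hu
  obtain ⟨M, -, hM⟩ := (Set.toFinite {M | P M}).exists_le_minimal hP0
  obtain ⟨⟨hbad, hdeg, hctl⟩, hMmin⟩ := hM
  refine ⟨M, hbad, hdeg, fun u v hu hv hG => ?_⟩
  by_contra hnr
  obtain ⟨H, hH, hHu⟩ := hctl u hu
  obtain ⟨K, hK, hKv⟩ := hctl v hv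
  obtain ⟨p, hp⟩ := (hT.preconnected u v).exists_isPath
  have hgood : ∀ x ∈ p.support, x ∈ M → (T.neighborSet x).ncard ≤ k := by
    intro x hxp hxM
    by_contra! hx
    obtain ⟨L, hL, hLx⟩ := IsControlledRewiring.exists_swap (C := Set.univ) hu hv hG hnr hH hHu hK
      hKv hp (fun _ _ => trivial) (Set.subset_univ _) (Set.subset_univ _) hxp hxM
    refine (hmin L hL.le (hL.toIsRewiring.connected hT)).not_gt ?_
    exact Finset.sum_lt_sum (fun y _ => hL.excess_le y) ⟨x, Finset.mem_univ _, by omega⟩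
  let N : Set V := M \ {x | x ∈ p.support}
  have hNM : N ⊆ M := Set.sdiff_subset
  have hsupp : ∀ y ∈ p.support, y ∉ N := fun y hy h => h.2 hy
  have hPN : P N := by
    refine ⟨fun w hw => ⟨hbad w hw, fun h => ?_⟩, fun w hw => hdeg w hw.1, fun x hx => ?_⟩
    · exact (hgood w h (hbad w hw)).not_gt hw
    · by_cases hxM : x ∈ M
      · have hxp : x ∈ p.support := by
          by_contra h
          exact hx ⟨hxM, h⟩
        have hsC := p.mem_compAvoiding hsupp
        have hcomp : ∀ y ∈ p.support, T.compAvoiding N y ⊆ T.compAvoiding N x := fun y hy z hz =>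
          (Reachable.trans (Reachable.symm (hsC x hxp)) (hsC y hy)).trans hz
        obtain ⟨L, hL, hLx⟩ := IsControlledRewiring.exists_swap (C := T.compAvoiding N x) hu hv hG
          hnr hH hHu hK hKv hp
          (fun y hy => hcomp y hy (T.mem_compAvoiding_self N y))
          ((T.compAvoiding_anti hNM u).trans (hcomp u p.start_mem_support))
          ((T.compAvoiding_anti hNM v).trans (hcomp v p.end_mem_support)) hxp hxM
        exact ⟨L, hL, hLx.trans_le (hgood x hxp hxM)⟩
      · obtain ⟨L, hL, hLx⟩ := hctl x hxM
        exact ⟨L, ⟨hL.toIsRewiring.mono (T.compAvoiding_anti hNM x), hL.le, hL.excess_le⟩, hLx⟩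
  have hMN : M ⊆ N := hMmin hPN hNM
  apply hnr
  exact p.mem_compAvoiding (fun y hy h => (hMN h).2 hy) v p.end_mem_support

theorem card_le_card_edgeSet_add_card_connectedComponent [Finite V] (F : SimpleGraph V) :
    Nat.card V ≤ F.edgeSet.ncard + Nat.card F.ConnectedComponent := by
  classical
  rcases isEmpty_or_nonempty V with hV | ⟨⟨v₀⟩⟩
  · simp
  have : Fintype V := Fintype.ofFinite V
  let c₀ := F.connectedComponentMk v₀
  let S : Set (Sym2 V) := (fun c : F.ConnectedComponent => s(c₀.out, c.out)) '' {c₀}ᶜ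
  have hout : ∀ v, F.Reachable v (F.connectedComponentMk v).out := fun v =>
    ConnectedComponent.exact (Quot.out_eq (F.connectedComponentMk v)).symm
  have hstar : ∀ c : F.ConnectedComponent, (F ⊔ fromEdgeSet S).Reachable c₀.out c.out := by
    intro c
    by_cases hc : c.out = c₀.out
    · rw [hc]
    · refine Adj.reachable (Or.inr ((fromEdgeSet_adj _).2 ⟨⟨c, fun h => hc ?_, rfl⟩, Ne.symm hc⟩))
      rw [Set.mem_singleton_iff.1 h]
  have hconn : (F ⊔ fromEdgeSet S).Connected := by
    refine connected_iff_exists_forall_reachable _ |>.2 ⟨c₀.out, fun v => ?_⟩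
    exact (hstar _).trans ((hout v).symm.mono le_sup_left)
  have h1 := hconn.card_vert_le_card_edgeSet_add_one
  have h2 : (F ⊔ fromEdgeSet S).edgeSet ⊆ F.edgeSet ∪ S := by
    rw [edgeSet_sup, edgeSet_fromEdgeSet]
    exact Set.union_subset_union_right _ Set.sdiff_subset
  have h3 := (Set.ncard_le_ncard h2 (Set.toFinite _)).trans (Set.ncard_union_le _ _)
  have h4 : S.ncard ≤ ({c₀}ᶜ : Set F.ConnectedComponent).ncard := Set.ncard_image_le
  have h5 := Set.ncard_add_ncard_compl ({c₀} : Set F.ConnectedComponent)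
  rw [Set.ncard_singleton] at h5
  rw [Nat.card_coe_set_eq] at h1
  omega

theorem IsAcyclic.ncard_edgeSet_lt [Finite V] [Nonempty V] {F : SimpleGraph V}
    (hF : F.IsAcyclic) : F.edgeSet.ncard < Nat.card V := by
  classical
  have : Fintype V := Fintype.ofFinite V
  obtain ⟨T, hFT, -, hT⟩ := connected_top.exists_isTree_le_of_le_of_isAcyclic le_top hF
  have h1 := hT.card_edgeFinset
  have h2 := Set.ncard_le_ncard (edgeSet_mono hFT)
  rw [← coe_edgeFinset T, Set.ncard_coe_finset] at h2
  rw [Nat.card_eq_fintype_card]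
  omega

theorem ncard_edgeSet_inside_lt [Finite V] {T : SimpleGraph V} (hT : T.IsAcyclic) {M : Set V}
    (hM : M.Nonempty) : (T.inside M).edgeSet.ncard < M.ncard := by
  have : Nonempty M := hM.to_subtype
  have h1 := (hT.induce M).ncard_edgeSet_lt
  rw [Nat.card_coe_set_eq] at h1
  refine lt_of_le_of_lt ?_ h1
  have h2 : (T.inside M).edgeSet ⊆ Sym2.map Subtype.val '' (T.induce M).edgeSet := by
    intro e
    induction e with
    | h a b =>
      rintro ⟨h, ha, hb⟩
      exact ⟨s(⟨a, ha⟩, ⟨b, hb⟩), h, rfl⟩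
  exact (Set.ncard_le_ncard h2).trans Set.ncard_image_le

open Classical in
theorem ncard_neighborSet_eq_sum [Fintype V] (F : SimpleGraph V) (v : V) :
    ((F.neighborSet v).ncard : ℤ) = ∑ b, if F.Adj v b then 1 else 0 := by
  rw [Set.ncard_eq_toFinset_card']
  simp

open Classical in
theorem sum_sum_adj [Fintype V] (F : SimpleGraph V) :
    ∑ a, ∑ b, (if F.Adj a b then (1 : ℤ) else 0) = 2 * F.edgeSet.ncard := by
  rw [← coe_edgeFinset, Set.ncard_coe_finset]
  have := F.sum_degrees_eq_twice_card_edges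
  zify at this
  rw [← this]
  refine Finset.sum_congr rfl fun a _ => ?_
  rw [← ncard_neighborSet_eq_sum, Set.ncard_eq_toFinset_card',
    Set.toFinset_card, card_neighborSet_eq_degree]

/-- Deleting a nonempty set `M` from a tree leaves at least `2 + ∑ (d(v) - 2)` components. -/
theorem IsTree.le_card_components_avoiding [Fintype V] {T : SimpleGraph V} (hT : T.IsTree)
    {M : Finset V} (hM : M.Nonempty) :
    (2 : ℤ) + ∑ v ∈ M, (((T.neighborSet v).ncard : ℤ) - 2) ≤
      ((T.inside (M : Set V)ᶜ).connectedComponentMk '' (M : Set V)ᶜ).ncard := by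
  classical
  set F := T.inside (M : Set V)ᶜ with hF
  have h1 := F.card_le_card_edgeSet_add_card_connectedComponent
  have h2 : Nat.card F.ConnectedComponent ≤ M.card +
      (F.connectedComponentMk '' (M : Set V)ᶜ).ncard := by
    rw [← Set.ncard_univ]
    have : (Set.univ : Set F.ConnectedComponent) ⊆ F.connectedComponentMk '' (M : Set V) ∪
        F.connectedComponentMk '' (M : Set V)ᶜ := by
      rw [← Set.image_union, Set.union_compl_self]
      intro c _
      obtain ⟨v, rfl⟩ := c.exists_rep
      exact ⟨v, trivial, rfl⟩
    refine (Set.ncard_le_ncard this (Set.toFinite _)).trans ((Set.ncard_union_le _ _).trans ?_)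
    gcongr
    exact (Set.ncard_image_le (Set.toFinite _)).trans (Set.ncard_coe_finset M).le
  have h3 := ncard_edgeSet_inside_lt hT.isAcyclic (M := (M : Set V)) hM
  rw [Set.ncard_coe_finset] at h3
  have h4 := hT.card_edgeFinset
  have h4' : T.edgeSet.ncard = T.edgeFinset.card := by
    rw [← coe_edgeFinset, Set.ncard_coe_finset]
  rw [Nat.card_eq_fintype_card] at h1
  have h5 : (F.edgeSet.ncard : ℤ) = T.edgeSet.ncard + (T.inside (M : Set V)).edgeSet.ncard -
      ∑ v ∈ M, ((T.neighborSet v).ncard : ℤ) := by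
    have e1 := sum_sum_adj T
    have e2 := sum_sum_adj F
    have e3 := sum_sum_adj (T.inside (M : Set V))
    have e4 : ∑ v ∈ M, ((T.neighborSet v).ncard : ℤ) =
        ∑ a, ∑ b, if a ∈ M ∧ T.Adj a b then (1 : ℤ) else 0 := by
      rw [← Finset.sum_filter_add_sum_filter_not Finset.univ (· ∈ M), Finset.filter_univ_mem]
      rw [Finset.sum_congr rfl fun a ha => ncard_neighborSet_eq_sum T a]
      rw [Finset.sum_eq_zero (s := Finset.univ.filter (· ∉ M))]
      · rw [add_zero]
        refine Finset.sum_congr rfl fun a ha => ?_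
        simp [ha]
      · intro a ha
        simp_all
    have e5 : ∑ v ∈ M, ((T.neighborSet v).ncard : ℤ) =
        ∑ a, ∑ b, if b ∈ M ∧ T.Adj a b then (1 : ℤ) else 0 := by
      rw [e4, Finset.sum_comm]
      simp only [T.adj_comm]
    have e6 : ∑ a, ∑ b, (if F.Adj a b then (1 : ℤ) else 0) =
        ∑ a, ∑ b, (if T.Adj a b then (1 : ℤ) else 0) +
        ∑ a, ∑ b, (if (T.inside (M : Set V)).Adj a b then (1 : ℤ) else 0) -
        ∑ a, ∑ b, (if a ∈ M ∧ T.Adj a b then (1 : ℤ) else 0) -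
        ∑ a, ∑ b, (if b ∈ M ∧ T.Adj a b then (1 : ℤ) else 0) := by
      simp only [← Finset.sum_add_distrib, ← Finset.sum_sub_distrib]
      refine Finset.sum_congr rfl fun a _ => Finset.sum_congr rfl fun b _ => ?_
      have i1 : F.Adj a b ↔ T.Adj a b ∧ a ∉ M ∧ b ∉ M := Iff.rfl
      have i2 : (T.inside (M : Set V)).Adj a b ↔ T.Adj a b ∧ a ∈ M ∧ b ∈ M := Iff.rfl
      by_cases ha : a ∈ M <;> by_cases hb : b ∈ M <;> by_cases hab : T.Adj a b <;>
        simp [i1, i2, ha, hb, hab]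
    linarith
  rw [Finset.sum_sub_distrib]
  simp only [Finset.sum_const, nsmul_eq_mul]
  omega

/-- Win's theorem, in contrapositive form: a connected graph without a spanning tree of maximum
degree at most `k` has a nonempty set `S` whose removal leaves at least `(k - 2) |S| + 3`
components, here grouped into exactly that many classes by `f`. -/
theorem Connected.exists_separator_of_forall_isTree [Fintype V] {G : SimpleGraph V}
    (hG : G.Connected) {k : ℕ} (hk : 2 ≤ k)
    (hno : ∀ T ≤ G, T.IsTree → ∃ v, k < (T.neighborSet v).ncard) :
    ∃ S : Finset V, S.Nonempty ∧ ∃ f : V → Fin ((k - 2) * S.card + 3),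
      (∀ i, ∃ v, v ∉ S ∧ f v = i) ∧ ∀ u v, u ∉ S → v ∉ S → G.Adj u v → f u = f v := by
  classical
  have hdeg : ∀ {A B : SimpleGraph V}, A ≤ B → ∑ y, ((A.neighborSet y).ncard - k) ≤
      ∑ y, ((B.neighborSet y).ncard - k) := fun hAB => Finset.sum_le_sum fun y _ =>
    Nat.sub_le_sub_right (Set.ncard_le_ncard (fun _ hz => hAB hz)) k
  obtain ⟨H, ⟨hHG, hH⟩, hmin⟩ := Set.exists_min_image {H : SimpleGraph V | H ≤ G ∧ H.Connected}
    (fun H => ∑ y, ((H.neighborSet y).ncard - k)) (Set.toFinite _) ⟨G, le_rfl, hG⟩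
  obtain ⟨T, hTH, hT⟩ := hH.exists_isTree_le
  obtain ⟨M, hbad, hMdeg, hM⟩ := exists_barrier (hTH.trans hHG) hT.connected
    (fun K hK hK' => (hdeg hTH).trans (hmin K ⟨hK, hK'⟩))
  obtain ⟨w, hw⟩ := hno T (hTH.trans hHG) hT
  obtain ⟨S, rfl⟩ : ∃ S : Finset V, (S : Set V) = M := ⟨M.toFinset, by simp⟩
  have hwS : w ∈ S := hbad w hw
  refine ⟨S, ⟨w, hwS⟩, ?_⟩
  set F := T.inside (S : Set V)ᶜ with hF
  have hcount := hT.le_card_components_avoiding ⟨w, hwS⟩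
  have hsum : ((k : ℤ) - 2) * S.card + 1 ≤ ∑ v ∈ S, (((T.neighborSet v).ncard : ℤ) - 2) := by
    have : ∑ v ∈ S, ((k : ℤ) - 2) < ∑ v ∈ S, (((T.neighborSet v).ncard : ℤ) - 2) :=
      Finset.sum_lt_sum (fun v hv => by have := hMdeg v hv; omega) ⟨w, hwS, by omega⟩
    simp only [Finset.sum_const, nsmul_eq_mul] at this
    linarith
  set Q : Set F.ConnectedComponent := F.connectedComponentMk '' (S : Set V)ᶜ with hQ
  have hcard : (k - 2) * S.card + 3 ≤ Q.ncard := by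
    zify [hk]
    linarith
  obtain ⟨g, hg⟩ : ∃ g : Q → Fin ((k - 2) * S.card + 3), Function.Surjective g := by
    have : Fintype Q := Fintype.ofFinite Q
    have : Nonempty (Fin ((k - 2) * S.card + 3) ↪ Q) := by
      refine Function.Embedding.nonempty_of_card_le ?_
      rwa [Fintype.card_fin, ← Nat.card_eq_fintype_card, Nat.card_coe_set_eq]
    obtain ⟨e⟩ := this
    exact ⟨Function.invFun e, Function.invFun_surjective e.injective⟩
  refine ⟨fun v => if hv : v ∈ S then 0 else g ⟨F.connectedComponentMk v, v, hv, rfl⟩,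
    fun i => ?_, fun u v hu hv huv => ?_⟩
  · obtain ⟨⟨_, v, hv, rfl⟩, rfl⟩ := hg i
    exact ⟨v, hv, dif_neg hv⟩
  · have : F.connectedComponentMk u = F.connectedComponentMk v :=
      ConnectedComponent.sound (hM u v hu hv huv)
    simp only [dif_neg hu, dif_neg hv, this]

end SimpleGraph

section Spectral

open Matrix

/-- The Rayleigh quotient bound for the distance spectral radius. -/
theorem sum_dist_mul_le_distSpecRad_mul {V : Type*} [Fintype V] [DecidableEq V]
    (G : SimpleGraph V) (x : V → ℝ) :
    ∑ u, ∑ v, (G.dist u v : ℝ) * (x u * x v) ≤ distSpecRad G * ∑ v, x v ^ 2 := by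
  set L := distSpecRad G with hL
  have hfin : (spectrum ℝ (distMatrix G)).Finite := Matrix.finite_real_spectrum
  have hherm : (distMatrix G).IsHermitian := by
    ext u v
    simp [distMatrix, G.dist_comm]
  have hpsd : (algebraMap ℝ (Matrix V V ℝ) L - distMatrix G).PosSemidef := by
    rw [posSemidef_iff_isHermitian_and_spectrum_nonneg]
    refine ⟨?_, ?_⟩
    · rw [Algebra.algebraMap_eq_smul_one]
      exact (isHermitian_one.smul (IsSelfAdjoint.all L)).sub hherm
    · rw [← spectrum.singleton_sub_eq]
      rintro _ ⟨_, rfl, z, hz, rfl⟩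
      exact sub_nonneg.2 (le_csSup hfin.bddAbove hz)
  have h := hpsd.dotProduct_mulVec_nonneg x
  rw [Algebra.algebraMap_eq_smul_one, sub_mulVec, smul_mulVec, one_mulVec, dotProduct_sub,
    dotProduct_smul, sub_nonneg, star_trivial, smul_eq_mul] at h
  refine le_of_eq_of_le ?_ (h.trans_eq ?_)
  · simp only [dotProduct, mulVec, distMatrix, of_apply, Finset.mul_sum]
    exact Finset.sum_congr rfl fun u _ => Finset.sum_congr rfl fun v _ => by ring
  · simp only [dotProduct, sq]

/-- A positive supersolution of the eigenvalue equation bounds the distance spectral radius. -/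
theorem distSpecRad_le_of_sum_dist_mul_le {V : Type*} [Fintype V] [DecidableEq V]
    {G : SimpleGraph V} {μ : ℝ} (hμ : 0 ≤ μ) {y : V → ℝ} (hy : ∀ v, 0 < y v)
    (h : ∀ u, ∑ v, (G.dist u v : ℝ) * y v ≤ μ * y u) : distSpecRad G ≤ μ := by
  refine Real.sSup_le (fun l hl => ?_) hμ
  rw [← spectrum_toLin', ← Module.End.hasEigenvalue_iff_mem_spectrum] at hl
  obtain ⟨z, hz⟩ := hl.exists_hasEigenvector
  have hz1 : ∀ u, ∑ v, (G.dist u v : ℝ) * z v = l * z u := fun u => by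
    simpa [toLin'_apply, mulVec, dotProduct, distMatrix] using congrFun hz.apply_eq_smul u
  obtain ⟨w, hw⟩ := Function.ne_iff.1 hz.2
  have hpos : 0 < ∑ u, y u * |z u| :=
    Finset.sum_pos' (fun u _ => mul_nonneg (hy u).le (abs_nonneg _))
      ⟨w, Finset.mem_univ _, mul_pos (hy w) (abs_pos.2 hw)⟩
  have hle : l * ∑ u, y u * |z u| ≤ μ * ∑ u, y u * |z u| := by
    calc l * ∑ u, y u * |z u| = ∑ u, y u * (l * |z u|) := by
          rw [Finset.mul_sum]
          exact Finset.sum_congr rfl fun u _ => by ring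
      _ ≤ ∑ u, y u * ∑ v, (G.dist u v : ℝ) * |z v| := by
          refine Finset.sum_le_sum fun u _ => mul_le_mul_of_nonneg_left ?_ (hy u).le
          calc l * |z u| ≤ |l * z u| := by
                rw [abs_mul]
                exact mul_le_mul_of_nonneg_right (le_abs_self l) (abs_nonneg _)
            _ ≤ ∑ v, |(G.dist u v : ℝ) * z v| := by
                rw [← hz1]
                exact Finset.abs_sum_le_sum_abs _ _
            _ = ∑ v, (G.dist u v : ℝ) * |z v| := by simp [abs_mul]
      _ = ∑ v, (∑ u, (G.dist v u : ℝ) * y u) * |z v| := by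
          simp only [Finset.mul_sum, Finset.sum_mul]
          rw [Finset.sum_comm]
          refine Finset.sum_congr rfl fun v _ => Finset.sum_congr rfl fun u _ => ?_
          rw [G.dist_comm]
          ring
      _ ≤ ∑ v, μ * y v * |z v| :=
          Finset.sum_le_sum fun v _ => mul_le_mul_of_nonneg_right (h v) (abs_nonneg _)
      _ = μ * ∑ u, y u * |z u| := by
          rw [Finset.mul_sum]
          exact Finset.sum_congr rfl fun u _ => by ring
  exact le_of_mul_le_mul_right hle hpos

end Spectral

theorem starGraph_adj_center {n k : ℕ} (i : Fin 1) (x : Fin (n - k - 1) ⊕ Fin k) :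
    (starGraph n k).Adj (Sum.inl i) (Sum.inr x) := by
  simp [starGraph, graphJoin]

theorem starGraph_adj_inr {n k : ℕ} (x y : Fin (n - k - 1) ⊕ Fin k) :
    (starGraph n k).Adj (Sum.inr x) (Sum.inr y) ↔ x ≠ y ∧ x.isLeft ∧ y.isLeft := by
  rcases x with x | x <;> rcases y with y | y <;>
    simp [starGraph, graphJoin, graphDisjUnion]
  tauto

theorem starGraph_dist_le_two {n k : ℕ} (x y : Fin (n - k - 1) ⊕ Fin k) :
    (starGraph n k).dist (Sum.inr x) (Sum.inr y) ≤ 2 :=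
  SimpleGraph.dist_le (.cons (starGraph_adj_center 0 x).symm
    (.cons (starGraph_adj_center 0 y) .nil))

theorem distSpecRad_starGraph_le {n : ℕ} (hn : 6 ≤ n) {μ a b c : ℝ} (hμ : 0 ≤ μ) (ha : 0 < a)
    (hb : 0 < b) (hc : 0 < c) (h₁ : (n - 5) * b + 4 * c ≤ μ * a)
    (h₂ : a + (n - 6) * b + 8 * c ≤ μ * b) (h₃ : a + 2 * (n - 5) * b + 6 * c ≤ μ * c) :
    distSpecRad (starGraph n 4) ≤ μ := by
  have hcast : ((n - 4 - 1 : ℕ) : ℝ) = n - 5 := by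
    rw [Nat.sub_sub, Nat.cast_sub (by omega)]
    norm_num
  refine distSpecRad_le_of_sum_dist_mul_le hμ
    (y := Sum.elim (fun _ => a) (Sum.elim (fun _ => b) fun _ => c)) ?_ ?_
  · rintro (i | i | i) <;> simpa
  · rintro (i | i | i)
    · have hd : ∀ x, (starGraph n 4).dist (Sum.inl i) (Sum.inr x) = 1 := fun x =>
        SimpleGraph.dist_eq_one_iff_adj.2 (starGraph_adj_center i x)
      have h0 : (starGraph n 4).dist (Sum.inl i) (Sum.inl 0) = 0 := by
        rw [Subsingleton.elim i 0, SimpleGraph.dist_self]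
      simpa [Fintype.sum_sum_type, hd, h0, hcast] using h₁
    · have h0 : (starGraph n 4).dist (Sum.inr (Sum.inl i)) (Sum.inl 0) = 1 :=
        SimpleGraph.dist_eq_one_iff_adj.2 (starGraph_adj_center 0 _).symm
      have h1 : ∀ j, ((starGraph n 4).dist (Sum.inr (Sum.inl i)) (Sum.inr (Sum.inl j)) : ℝ) =
          1 - if i = j then 1 else 0 := by
        intro j
        split_ifs with hij
        · simp [hij]
        · rw [SimpleGraph.dist_eq_one_iff_adj.2]
          · simp
          · rw [starGraph_adj_inr]
            simpa using hij
      have h2 : ∑ j : Fin 4, ((starGraph n 4).dist (Sum.inr (Sum.inl i))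
          (Sum.inr (Sum.inr j)) : ℝ) * c ≤ ∑ j : Fin 4, 2 * c :=
        Finset.sum_le_sum fun j _ => mul_le_mul_of_nonneg_right
          (by exact_mod_cast starGraph_dist_le_two _ _) hc.le
      simp only [Fintype.sum_sum_type, Sum.elim_inl, Sum.elim_inr, Fin.sum_univ_one, h0, h1]
      rw [← Finset.sum_mul, Finset.sum_sub_distrib]
      simp only [Finset.sum_const, Finset.card_univ, Fintype.card_fin, nsmul_eq_mul, hcast,
        Finset.sum_ite_eq, Finset.mem_univ, if_true] at h2 ⊢
      push_cast at h2 ⊢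
      linarith
    · have h0 : (starGraph n 4).dist (Sum.inr (Sum.inr i)) (Sum.inl 0) = 1 :=
        SimpleGraph.dist_eq_one_iff_adj.2 (starGraph_adj_center 0 _).symm
      have h1 : ∑ j, ((starGraph n 4).dist (Sum.inr (Sum.inr i))
          (Sum.inr (Sum.inl j)) : ℝ) * b ≤ ∑ j : Fin (n - 4 - 1), 2 * b :=
        Finset.sum_le_sum fun j _ => mul_le_mul_of_nonneg_right
          (by exact_mod_cast starGraph_dist_le_two _ _) hb.le
      have h2 : ∑ j : Fin 4, ((starGraph n 4).dist (Sum.inr (Sum.inr i))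
          (Sum.inr (Sum.inr j)) : ℝ) * c ≤ ∑ j : Fin 4, (2 - if i = j then 2 else 0) * c := by
        refine Finset.sum_le_sum fun j _ => mul_le_mul_of_nonneg_right ?_ hc.le
        split_ifs with hij
        · simp [hij]
        · rw [sub_zero]
          exact_mod_cast starGraph_dist_le_two _ _
      rw [← Finset.sum_mul _ _ c, ← Finset.sum_mul _ _ c, Finset.sum_sub_distrib] at h2
      simp only [Fintype.sum_sum_type, Sum.elim_inl, Sum.elim_inr, Fin.sum_univ_one, h0]
      simp only [Finset.sum_const, Finset.card_univ, Fintype.card_fin, nsmul_eq_mul, hcast,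
        Finset.sum_ite_eq, Finset.mem_univ, if_true] at h1 h2 ⊢
      rw [← Finset.sum_mul _ _ c]
      push_cast at h1 h2 ⊢
      linarith

/-- The equations of a positive eigenvector of the distance matrix of `starGraph n 4` have a
solution, normalized to have value `1` on the clique. -/
theorem exists_starGraph_eigenvector {n : ℕ} (hn : 12 ≤ n) :
    ∃ μ a c : ℝ, (n : ℝ) ≤ μ ∧ 0 < a ∧ 1 ≤ c ∧ c < 2 ∧ c * (n + 2) ≤ 2 * n - 4 ∧
      (n - 5) + 4 * c = μ * a ∧ a + (n - 6) + 8 * c = μ ∧ a + 2 * (n - 5) + 6 * c = μ * c := by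
  have hn' : (12 : ℝ) ≤ n := by exact_mod_cast hn
  let c : ℝ → ℝ := fun l => 1 + (n - 6) / (l + 2)
  let a : ℝ → ℝ := fun l => ((n - 5) + 4 * c l) / l
  have hc : ∀ l : ℝ, n ≤ l → 1 ≤ c l ∧ c l < 2 := by
    intro l hl
    have h1 : 0 < l + 2 := by linarith
    have h2 : 0 ≤ (n - 6) / (l + 2) := div_nonneg (by linarith) h1.le
    have h3 : (n - 6) / (l + 2) < 1 := (div_lt_one h1).2 (by linarith)
    exact ⟨by simp only [c]; linarith, by simp only [c]; linarith⟩
  have hcont : ContinuousOn (fun l => l - (n - 6) - 8 * c l - a l) (Set.Icc (n : ℝ) (n + 20)) := by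
    have hc' : ContinuousOn c (Set.Icc (n : ℝ) (n + 20)) := by
      refine continuousOn_const.add (continuousOn_const.div (by fun_prop) fun l hl => ?_)
      have := hl.1
      linarith
    refine ((by fun_prop : ContinuousOn (fun l : ℝ => l - (n - 6)) _).sub
      (continuousOn_const.mul hc')).sub
      ((continuousOn_const.add (continuousOn_const.mul hc')).div continuousOn_id fun l hl => ?_)
    have := hl.1
    exact (by linarith : l ≠ 0)
  have ha : ∀ l : ℝ, n ≤ l → 0 < a l := fun l hl => by
    have := (hc l hl).1
    exact div_pos (by linarith) (by linarith)
  have h0 : (0 : ℝ) ∈ Set.Icc ((n : ℝ) - (n - 6) - 8 * c n - a n)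
      (((n : ℝ) + 20) - (n - 6) - 8 * c (n + 20) - a (n + 20)) := by
    constructor
    · have h1 := ha n le_rfl
      have h2 := (hc n le_rfl).1
      linarith
    · have h2 := (hc (n + 20) (by linarith)).2
      have : a (n + 20) ≤ 1 := (div_le_one (by linarith)).2 (by linarith)
      linarith
  obtain ⟨l, ⟨hl, -⟩, hl0⟩ := intermediate_value_Icc (by linarith) hcont h0
  have h1 : l + 2 ≠ 0 := by linarith
  have h2 : l ≠ 0 := by linarith
  have hcl : c l * (l + 2) = l + n - 4 := by
    simp only [c]
    field_simp
    ring
  have hal : l * a l = (n - 5) + 4 * c l := by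
    simp only [a]
    field_simp
  refine ⟨l, a l, c l, hl, ha l hl, (hc l hl).1, (hc l hl).2, ?_, hal.symm, by linarith, by linarith⟩
  have := (hc l hl).2
  nlinarith

section Separator

variable {V ι : Type*} [DecidableEq V] [DecidableEq ι]

/-- The distances in the graph which is complete except that vertices outside `S` in different
classes of `f` are not adjacent. -/
def separatedDist (S : Finset V) (f : V → ι) (u v : V) : ℕ :=
  if u = v then 0 else if u ∉ S ∧ v ∉ S ∧ f u ≠ f v then 2 else 1

theorem separatedDist_le_dist {G : SimpleGraph V} (hG : G.Connected) {S : Finset V} {f : V → ι}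
    (hf : ∀ u v, u ∉ S → v ∉ S → G.Adj u v → f u = f v) (u v : V) :
    separatedDist S f u v ≤ G.dist u v := by
  unfold separatedDist
  split_ifs with h1 h2
  · exact Nat.zero_le _
  · have h3 := hG.pos_dist_of_ne h1
    have h4 : G.dist u v ≠ 1 := fun h =>
      h2.2.2 (hf u v h2.1 h2.2.1 (SimpleGraph.dist_eq_one_iff_adj.1 h))
    omega
  · exact hG.pos_dist_of_ne h1

theorem sum_separatedDist_mul [Fintype V] [Fintype ι] (S : Finset V) (f : V → ι) (x : V → ℝ) :
    ∑ u, ∑ v, (separatedDist S f u v : ℝ) * (x u * x v) =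
      (∑ v, x v) ^ 2 - ∑ v, x v ^ 2 + (∑ v ∈ Sᶜ, x v) ^ 2 -
        ∑ i, (∑ v ∈ Sᶜ with f v = i, x v) ^ 2 := by
  have key : ∀ u v, (separatedDist S f u v : ℝ) * (x u * x v) =
      x u * x v - (if u = v then x u * x v else 0) +
        (if u ∈ Sᶜ then x u else 0) * (if v ∈ Sᶜ then x v else 0) -
        ∑ i, (if u ∈ Sᶜ ∧ f u = i then x u else 0) * (if v ∈ Sᶜ ∧ f v = i then x v else 0) := by
    intro u v
    have h : ∑ i, (if u ∈ Sᶜ ∧ f u = i then x u else 0) * (if v ∈ Sᶜ ∧ f v = i then x v else 0) =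
        if u ∉ S ∧ v ∉ S ∧ f u = f v then x u * x v else 0 := by
      rw [Finset.sum_eq_single (f u)]
      · by_cases hu : u ∈ S <;> by_cases hv : v ∈ S <;> simp [hu, hv, eq_comm]
      · intro i _ hi
        rw [if_neg (fun h => hi h.2.symm), zero_mul]
      · simp
    rw [h]
    unfold separatedDist
    by_cases huv : u = v
    · subst huv
      by_cases hu : u ∈ S <;> simp [hu]
    · by_cases hu : u ∈ S <;> by_cases hv : v ∈ S <;> by_cases hfe : f u = f v <;>
        simp [hu, hv, hfe, huv]
      ring
  simp only [key, Finset.sum_add_distrib, Finset.sum_sub_distrib]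
  congr 1
  · congr 1
    · rw [sq, Finset.sum_mul_sum]
      simp [sq]
    · rw [← Finset.sum_mul_sum, sq]
      rw [Finset.sum_ite_mem, Finset.univ_inter]
  · simp only [sq, Finset.sum_mul_sum, Finset.sum_filter, ite_and]
    simp only [← Finset.sum_mul_sum]
    rw [Finset.sum_congr rfl fun u _ => Finset.sum_comm, Finset.sum_comm]
    refine Finset.sum_congr rfl fun i _ => ?_
    rw [← Finset.sum_mul_sum, Finset.sum_ite_mem, Finset.univ_inter]

theorem sum_separatedDist_le_sum_dist [Fintype V] {G : SimpleGraph V} (hG : G.Connected)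
    {S : Finset V} {f : V → ι} (hf : ∀ u v, u ∉ S → v ∉ S → G.Adj u v → f u = f v)
    {x : V → ℝ} (hx : ∀ v, 0 < x v) :
    ∑ u, ∑ v, (separatedDist S f u v : ℝ) * (x u * x v) ≤
      ∑ u, ∑ v, (G.dist u v : ℝ) * (x u * x v) :=
  Finset.sum_le_sum fun u _ => Finset.sum_le_sum fun v _ => mul_le_mul_of_nonneg_right
    (by exact_mod_cast separatedDist_le_dist hG hf u v) (mul_pos (hx u) (hx v)).le

theorem dist_eq_separatedDist [Fintype V] {G : SimpleGraph V} (hG : G.Connected)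
    {S : Finset V} {f : V → ι} (hf : ∀ u v, u ∉ S → v ∉ S → G.Adj u v → f u = f v)
    {x : V → ℝ} (hx : ∀ v, 0 < x v)
    (h : ∑ u, ∑ v, (G.dist u v : ℝ) * (x u * x v) ≤
      ∑ u, ∑ v, (separatedDist S f u v : ℝ) * (x u * x v)) (u v : V) :
    G.dist u v = separatedDist S f u v := by
  have hle : ∀ u v, (separatedDist S f u v : ℝ) * (x u * x v) ≤ (G.dist u v : ℝ) * (x u * x v) :=
    fun u v => mul_le_mul_of_nonneg_right
      (by exact_mod_cast separatedDist_le_dist hG hf u v) (mul_pos (hx u) (hx v)).le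
  have h' := le_antisymm (sum_separatedDist_le_sum_dist hG hf hx) h
  rw [Finset.sum_eq_sum_iff_of_le fun u _ => Finset.sum_le_sum fun v _ => hle u v] at h'
  have h2 := h' u (Finset.mem_univ u)
  rw [Finset.sum_eq_sum_iff_of_le fun v _ => hle u v] at h2
  have h3 := mul_right_cancel₀ (mul_pos (hx u) (hx v)).ne' (h2 v (Finset.mem_univ v))
  exact_mod_cast h3.symm

/-- Among class sizes with given sum, the sum of squares of the weights is largest when one class
contains everything but single vertices. -/
theorem sum_sq_class_weight_le [Fintype ι] {N : ι → ℕ} (hN : ∀ i, 1 ≤ N i) {m : ι}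
    (hm : ∀ i, N i ≤ N m) {J : Finset ι} (hJ : J.card = 4) (hmJ : m ∉ J) (c : ℝ) :
    ∑ i, ((N i : ℝ) + (c - 1) * if i ∈ J then 1 else 0) ^ 2 ≤
      4 * c ^ 2 + (Fintype.card ι - 5) + (1 + (∑ i, (N i : ℝ) - Fintype.card ι)) ^ 2 -
        2 * (2 - c) * ∑ i ∈ J, ((N i : ℝ) - 1) := by
  let e : ι → ℝ := fun i => (N i : ℝ) - 1
  have he : ∀ i, 0 ≤ e i := fun i => by
    have : (1 : ℝ) ≤ N i := by exact_mod_cast hN i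
    simp only [e]
    linarith
  have hem : ∀ i, e i ≤ e m * e i := fun i => by
    by_cases h : N i = 1
    · simp [e, h]
    · have h1 : 2 ≤ N m := by have := hN i; have := hm i; omega
      have h2 : (1 : ℝ) ≤ e m := by
        have : (2 : ℝ) ≤ N m := by exact_mod_cast h1
        simp only [e]
        linarith
      nlinarith [he i]
  have hE : ∑ i, (N i : ℝ) - Fintype.card ι = ∑ i, e i := by
    simp [e, Finset.sum_sub_distrib]
  have hsplit : ∀ g : ι → ℝ, ∑ i, g i = g m + ∑ i ∈ Finset.univ.erase m, g i := fun g =>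
    (Finset.add_sum_erase _ _ (Finset.mem_univ m)).symm
  have hJm : J ⊆ Finset.univ.erase m := fun i hi =>
    Finset.mem_erase.2 ⟨fun h => hmJ (h ▸ hi), Finset.mem_univ i⟩
  have h1 : ∑ i ∈ J, e i ≤ e m * ∑ i ∈ Finset.univ.erase m, e i := by
    rw [Finset.mul_sum]
    refine (Finset.sum_le_sum fun i _ => hem i).trans
      (Finset.sum_le_sum_of_subset_of_nonneg hJm fun i _ _ => mul_nonneg (he m) (he i))
  have h2 : ∑ i ∈ Finset.univ.erase m, e i ^ 2 ≤ (∑ i ∈ Finset.univ.erase m, e i) ^ 2 :=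
    Finset.sum_sq_le_sq_sum_of_nonneg fun i _ => he i
  have h3 : ∑ i, e i ^ 2 + 2 * ∑ i ∈ J, e i ≤ (∑ i, e i) ^ 2 := by
    rw [hsplit e, hsplit fun i => e i ^ 2]
    nlinarith
  have h4 : ∑ i, ((N i : ℝ) + (c - 1) * if i ∈ J then 1 else 0) ^ 2 =
      Fintype.card ι + 2 * ∑ i, e i + ∑ i, e i ^ 2 + 2 * (c - 1) * (4 + ∑ i ∈ J, e i) +
        4 * (c - 1) ^ 2 := by
    have h5 : ∀ g : ι → ℝ, ∑ i ∈ J, g i = ∑ i, if i ∈ J then g i else 0 := fun g => by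
      simp
    have h6 : (4 : ℝ) = ∑ i, if i ∈ J then 1 else 0 := by
      simp [hJ]
    have h7 : ∀ i, ((N i : ℝ) + (c - 1) * if i ∈ J then 1 else 0) ^ 2 =
        1 + 2 * e i + e i ^ 2 + 2 * (c - 1) * ((if i ∈ J then 1 else 0) + if i ∈ J then e i else 0) +
          (if i ∈ J then 1 else 0) * (c - 1) ^ 2 := by
      intro i
      simp only [e]
      split_ifs <;> ring
    simp only [h7, Finset.sum_add_distrib, ← Finset.mul_sum, ← Finset.sum_mul, ← h5 e, ← h6]
    simp
  rw [h4, hE]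
  linarith

/-- The vector with entry `a` at `s`, entries `c` on `R` and entries `1` elsewhere. -/
noncomputable def threeWeight (s : V) (R : Finset V) (a c : ℝ) (v : V) : ℝ :=
  if v = s then a else if v ∈ R then c else 1

theorem threeWeight_pos {s : V} {R : Finset V} {a c : ℝ} (ha : 0 < a) (hc : 0 < c) (v : V) :
    0 < threeWeight s R a c v := by
  unfold threeWeight
  split_ifs <;> first | assumption | exact one_pos

theorem sum_threeWeight [Fintype V] {s : V} {R : Finset V} (hR : R.card = 4) (hs : s ∉ R)
    (a c : ℝ) (φ : ℝ → ℝ) :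
    ∑ v, φ (threeWeight s R a c v) = φ a + 4 * φ c + (Fintype.card V - 5) * φ 1 := by
  have h : ∀ v, φ (threeWeight s R a c v) =
      φ 1 + (if v = s then φ a - φ 1 else 0) + if v ∈ R then φ c - φ 1 else 0 := by
    intro v
    unfold threeWeight
    by_cases h1 : v = s
    · subst h1
      simp [hs]
    · by_cases h2 : v ∈ R <;> simp [h1, h2]
  simp only [h, Finset.sum_add_distrib, Finset.sum_ite_eq', Finset.sum_ite_mem]
  simp [hR]
  ring

theorem exists_le_sum_separatedDist_threeWeight [Fintype V] [Fintype ι] {S : Finset V}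
    {f : V → ι} (hsurj : ∀ i, ∃ v, v ∉ S ∧ f v = i) {s : V} (hs : s ∈ S)
    (hι : 5 ≤ Fintype.card ι) (a c : ℝ) :
    ∃ (R : Finset V) (m : ι) (J : Finset ι), R.card = 4 ∧ s ∉ R ∧ J.card = 4 ∧ m ∉ J ∧
      (∀ i, 1 ≤ Finset.card {v ∈ Sᶜ | f v = i}) ∧
      (a + 4 * c + (Fintype.card V - 5)) ^ 2 - (a ^ 2 + 4 * c ^ 2 + (Fintype.card V - 5)) +
        ((Fintype.card V - S.card) + 4 * (c - 1)) ^ 2 -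
        (4 * c ^ 2 + (Fintype.card ι - 5) +
          (1 + (Fintype.card V - S.card - Fintype.card ι)) ^ 2) +
        2 * (2 - c) * ∑ i ∈ J, ((Finset.card {v ∈ Sᶜ | f v = i} : ℝ) - 1) ≤
      ∑ u, ∑ v, (separatedDist S f u v : ℝ) *
        (threeWeight s R a c u * threeWeight s R a c v) := by
  choose r hrS hr using hsurj
  set N : ι → ℕ := fun i => Finset.card {v ∈ Sᶜ | f v = i} with hNdef
  have hN : ∀ i, 1 ≤ N i := fun i =>
    Finset.card_pos.2 ⟨r i, by simp [hrS i, hr i]⟩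
  have : Nonempty ι := Fintype.card_pos_iff.1 (by omega)
  obtain ⟨m, -, hm⟩ := Finset.exists_max_image Finset.univ N Finset.univ_nonempty
  obtain ⟨J, hJm, hJ⟩ : ∃ J ⊆ Finset.univ.erase m, J.card = 4 :=
    Finset.exists_subset_card_eq (by
      rw [Finset.card_erase_of_mem (Finset.mem_univ m), Finset.card_univ]; omega)
  have hmJ : m ∉ J := fun h => (Finset.mem_erase.1 (hJm h)).1 rfl
  have hinj : Function.Injective r := fun i j h => by rw [← hr i, h, hr j]
  have hR : (J.image r).card = 4 := by rw [Finset.card_image_of_injective _ hinj, hJ]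
  have hsR : s ∉ J.image r := fun h => by
    obtain ⟨i, -, rfl⟩ := Finset.mem_image.1 h
    exact hrS i hs
  refine ⟨J.image r, m, J, hR, hsR, hJ, hmJ, hN, ?_⟩
  have hclass : ∀ i, ∑ v ∈ Sᶜ with f v = i, threeWeight s (J.image r) a c v =
      (N i : ℝ) + (c - 1) * if i ∈ J then 1 else 0 := by
    intro i
    have h1 : ∀ v ∈ ({v ∈ Sᶜ | f v = i} : Finset V), threeWeight s (J.image r) a c v =
        1 + if i ∈ J ∧ v = r i then c - 1 else 0 := by
      intro v hv
      simp only [Finset.mem_filter, Finset.mem_compl] at hv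
      have hvs : v ≠ s := fun h => hv.1 (h ▸ hs)
      have h2 : v ∈ J.image r ↔ i ∈ J ∧ v = r i := by
        rw [Finset.mem_image]
        constructor
        · rintro ⟨j, hj, rfl⟩
          rw [← hv.2, hr j]
          exact ⟨hj, rfl⟩
        · rintro ⟨hi, rfl⟩
          exact ⟨i, hi, rfl⟩
      simp only [threeWeight, if_neg hvs, h2]
      split_ifs <;> ring
    rw [Finset.sum_congr rfl h1, Finset.sum_add_distrib]
    congr 1
    · simp [N]
    · by_cases hi : i ∈ J
      · simp [hi, hrS i, hr i]
      · simp [hi]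
  have hNsum : ∑ i, (N i : ℝ) = Fintype.card V - S.card := by
    have h := Finset.card_eq_sum_card_fiberwise (f := f) (s := Sᶜ) (t := Finset.univ)
      (fun v _ => Finset.mem_coe.2 (Finset.mem_univ _))
    have h2 := Finset.card_add_card_compl S
    rw [h] at h2
    rw [← h2]
    push_cast
    ring
  have hW : ∑ v ∈ Sᶜ, threeWeight s (J.image r) a c v =
      (Fintype.card V - S.card) + 4 * (c - 1) := by
    rw [← Finset.sum_fiberwise Sᶜ f]
    simp only [hclass, Finset.sum_add_distrib, ← Finset.mul_sum, hNsum]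
    simp [hJ]
    ring
  have hkey := sum_sq_class_weight_le hN (fun i => hm i (Finset.mem_univ i)) hJ hmJ c
  rw [sum_separatedDist_mul, hW, sum_threeWeight hR hsR a c fun y => y ^ 2,
    sum_threeWeight hR hsR a c fun y => y]
  simp only [hclass]
  rw [hNsum] at hkey
  linarith

end Separator

theorem nonempty_iso_starGraph_of_dist_eq {V ι : Type*} [Fintype V] [DecidableEq V] [Fintype ι]
    [DecidableEq ι] {G : SimpleGraph V} {s : V} {f : V → ι} {m : ι} {n : ℕ}
    (hn : Fintype.card V = n) (hn5 : 5 ≤ n) (hι : Fintype.card ι = 5)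
    (hdist : ∀ u v, G.dist u v = separatedDist {s} f u v)
    (hclass : ∀ i ≠ m, Finset.card {v ∈ ({s} : Finset V)ᶜ | f v = i} = 1) :
    Nonempty (G ≃g starGraph n 4) := by
  have hadj : ∀ u v, G.Adj u v ↔ u ≠ v ∧ (u ≠ s → v ≠ s → f u = f v) := by
    intro u v
    rw [← SimpleGraph.dist_eq_one_iff_adj, hdist]
    unfold separatedDist
    by_cases h1 : u = v <;> by_cases h2 : u = s <;> by_cases h3 : v = s <;>
      by_cases h4 : f u = f v <;> simp [h1, h2, h3, h4]
  set A : Finset V := {v ∈ ({s} : Finset V)ᶜ | f v = m} with hA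
  set R : Finset V := {v ∈ ({s} : Finset V)ᶜ | f v ≠ m} with hR
  have hAR : A.card + R.card = n - 1 := by
    rw [hA, hR, Finset.card_filter_add_card_filter_not, Finset.card_compl, hn,
      Finset.card_singleton]
  have hRcard : R.card = 4 := by
    rw [Finset.card_eq_sum_card_fiberwise (f := f) (t := Finset.univ.erase m)
      (fun v hv => by simpa [hR] using (Finset.mem_filter.1 hv).2)]
    rw [Finset.sum_congr rfl (g := fun _ => 1), Finset.sum_const,
      Finset.card_erase_of_mem (Finset.mem_univ m), Finset.card_univ, hι]
    · rfl
    · intro i hi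
      have hi := (Finset.mem_erase.1 hi).1
      rw [← hclass i hi, hR, Finset.filter_filter]
      congr 1
      ext v
      simp only [Finset.mem_filter]
      exact ⟨fun h => ⟨h.1, h.2.2⟩, fun h => ⟨h.1, h.2 ▸ hi, h.2⟩⟩
  have hinj : ∀ u ∈ R, ∀ v ∈ R, f u = f v → u = v := by
    intro u hu v hv h
    have hu := Finset.mem_filter.1 hu
    have hv := Finset.mem_filter.1 hv
    exact Finset.card_le_one.1 (hclass (f u) hu.2).le u (Finset.mem_filter.2 ⟨hu.1, rfl⟩) v
      (Finset.mem_filter.2 ⟨hv.1, h.symm⟩)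
  have e₁ : Fin (n - 4 - 1) ≃ A := (Finset.equivFinOfCardEq (by omega)).symm
  have e₂ : Fin 4 ≃ R := (Finset.equivFinOfCardEq hRcard).symm
  have h₁ : ∀ i, (e₁ i : V) ≠ s ∧ f (e₁ i) = m := fun i => by
    simpa using Finset.mem_filter.1 (e₁ i).2
  have h₂ : ∀ i, (e₂ i : V) ≠ s ∧ f (e₂ i) ≠ m := fun i => by
    simpa using Finset.mem_filter.1 (e₂ i).2
  have h₂' : ∀ i j, f (e₂ i) = f (e₂ j) → i = j := fun i j h =>
    e₂.injective (Subtype.ext (hinj _ (e₂ i).2 _ (e₂ j).2 h))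
  have h₁' : ∀ i j, (e₁ i : V) = e₁ j → i = j := fun i j h => e₁.injective (Subtype.ext h)
  have h₁₂ : ∀ i j, (e₁ i : V) ≠ e₂ j := fun i j h => (h₂ j).2 (h ▸ (h₁ i).2)
  let φ : Fin 1 ⊕ (Fin (n - 4 - 1) ⊕ Fin 4) → V :=
    Sum.elim (fun _ => s) (Sum.elim (fun i => e₁ i) fun i => e₂ i)
  have hφ : Function.Injective φ := by
    rintro (x | x | x) (y | y | y) h <;> simp only [φ, Sum.elim_inl, Sum.elim_inr] at h
    · rw [Subsingleton.elim x y]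
    · exact absurd h.symm (h₁ y).1
    · exact absurd h.symm (h₂ y).1
    · exact absurd h (h₁ x).1
    · rw [h₁' x y h]
    · exact absurd h (h₁₂ x y)
    · exact absurd h (h₂ x).1
    · exact absurd h.symm (h₁₂ y x)
    · rw [h₂' x y (congrArg f h)]
  have hφb : Function.Bijective φ := by
    refine (Fintype.bijective_iff_injective_and_card φ).2 ⟨hφ, ?_⟩
    simp only [Fintype.card_sum, Fintype.card_fin, hn]
    omega
  refine ⟨(RelIso.symm ⟨Equiv.ofBijective φ hφb, ?_⟩)⟩
  intro x y
  rw [Equiv.ofBijective_apply, Equiv.ofBijective_apply, hadj, hφ.ne_iff]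
  rcases x with x | x <;> rcases y with y | y
  · simp [Subsingleton.elim x y]
  · simp [φ, starGraph_adj_center]
  · simp [φ, (starGraph_adj_center y x).symm]
  · rw [starGraph_adj_inr, Sum.inr_injective.ne_iff, and_congr_right_iff]
    intro hxy
    rcases x with x | x <;> rcases y with y | y <;>
      simp only [φ, Sum.elim_inl, Sum.elim_inr, ne_eq, (h₁ _).1, (h₂ _).1, (h₁ _).2, (h₂ _).2,
        not_false_eq_true, forall_const, Sum.isLeft_inl, Sum.isLeft_inr, and_self, and_false,
        false_and, Bool.false_eq_true, iff_false]
    · exact fun h => (h₂ y).2 h.symm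
    · exact fun h => hxy (by rw [h₂' x y h])

theorem nonempty_iso_starGraph_of_separator {V : Type*} [Fintype V] [DecidableEq V]
    {n : ℕ} (hcard : Fintype.card V = n) (hn : 12 ≤ n) {G : SimpleGraph V} (hG : G.Connected)
    (hspec : distSpecRad G ≤ distSpecRad (starGraph n 4)) {S : Finset V} (hS : S.Nonempty)
    {f : V → Fin (2 * S.card + 3)} (hsurj : ∀ i, ∃ v, v ∉ S ∧ f v = i)
    (hf : ∀ u v, u ∉ S → v ∉ S → G.Adj u v → f u = f v) :
    Nonempty (G ≃g starGraph n 4) := by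
  obtain ⟨s, hs⟩ := hS
  have hS1 : 1 ≤ S.card := Finset.card_pos.2 ⟨s, hs⟩
  have hSn : 3 * S.card + 3 ≤ n := by
    choose r hrS hr using hsurj
    have hinj : Function.Injective r := fun i j h => by rw [← hr i, h, hr j]
    have h := Finset.card_le_univ (S ∪ Finset.univ.image r)
    rw [Finset.card_union_of_disjoint, Finset.card_image_of_injective _ hinj, Finset.card_univ,
      Fintype.card_fin, hcard] at h
    · omega
    · rw [Finset.disjoint_right]
      intro v hv
      obtain ⟨i, -, rfl⟩ := Finset.mem_image.1 hv
      exact hrS i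
  have hupper : ∀ {μ : ℝ}, distSpecRad (starGraph n 4) ≤ μ → ∀ x : V → ℝ,
      ∑ u, ∑ v, (G.dist u v : ℝ) * (x u * x v) ≤ μ * ∑ v, x v ^ 2 := fun hμ x =>
    (sum_dist_mul_le_distSpecRad_mul G x).trans
      (mul_le_mul_of_nonneg_right (hspec.trans hμ) (Finset.sum_nonneg fun v _ => sq_nonneg _))
  by_cases hex : S.card = 3 ∧ n = 12
  · exfalso
    obtain ⟨hS3, rfl⟩ := hex
    have hμ : distSpecRad (starGraph 12 4) ≤ 17.5 :=
      distSpecRad_starGraph_le (a := 57) (b := 76) (c := 100) (by norm_num) (by norm_num)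
        (by norm_num) (by norm_num) (by norm_num) (by norm_num) (by norm_num) (by norm_num)
    let x : V → ℝ := fun v => if v ∈ S then 2 else 3
    have hx : ∀ v, 0 < x v := fun v => by
      simp only [x]
      split_ifs <;> norm_num
    have hcompl : (Sᶜ).card = 9 := by rw [Finset.card_compl, hcard, hS3]
    have hfib : ∀ i, Finset.card {v ∈ Sᶜ | f v = i} = 1 := by
      have h1 : ∀ i ∈ Finset.univ, 1 ≤ Finset.card {v ∈ Sᶜ | f v = i} := fun i _ => by
        obtain ⟨v, hv, hvi⟩ := hsurj i
        exact Finset.card_pos.2 ⟨v, by simp [hv, hvi]⟩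
      have h2 := Finset.card_eq_sum_card_fiberwise (f := f) (s := Sᶜ) (t := Finset.univ)
        (fun v _ => Finset.mem_coe.2 (Finset.mem_univ _))
      have h3 := (Finset.sum_eq_sum_iff_of_le h1).1 (by
        rw [← h2, hcompl]
        simp [hS3])
      exact fun i => (h3 i (Finset.mem_univ i)).symm
    have hsum : ∀ φ : ℝ → ℝ, ∑ v, φ (x v) = 3 * φ 2 + 9 * φ 3 := fun φ => by
      rw [← Finset.sum_add_sum_compl S, Finset.sum_congr rfl (g := fun _ => φ 2),
        Finset.sum_congr (s₁ := Sᶜ) rfl (g := fun _ => φ 3)]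
      · simp [hS3, hcompl]
      · intro v hv
        simp [x, Finset.mem_compl.1 hv]
      · intro v hv
        simp [x, hv]
    have hout : ∀ v ∈ Sᶜ, x v = 3 := fun v hv => if_neg (Finset.mem_compl.1 hv)
    have hsq : ∀ i, (∑ v ∈ Sᶜ with f v = i, x v) ^ 2 = 9 := fun i => by
      rw [Finset.sum_congr rfl fun v hv => hout v (Finset.mem_filter.1 hv).1, Finset.sum_const,
        hfib i]
      norm_num
    have hlow := (sum_separatedDist_le_sum_dist hG hf hx).trans (hupper hμ x)
    rw [sum_separatedDist_mul, hsum fun y => y ^ 2, hsum fun y => y, Finset.sum_congr rfl hout,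
      Finset.sum_congr rfl fun i _ => hsq i] at hlow
    simp only [Finset.sum_const, Finset.card_univ, Fintype.card_fin, hcompl, hS3,
      nsmul_eq_mul] at hlow
    norm_num at hlow
  obtain ⟨μ, a, c, hμn, ha, hc1, hc2, hcn, h₁, h₂, h₃⟩ := exists_starGraph_eigenvector hn
  have hn' : (12 : ℝ) ≤ n := by exact_mod_cast hn
  have hμ : distSpecRad (starGraph n 4) ≤ μ :=
    distSpecRad_starGraph_le (by omega) (by linarith) ha one_pos (by linarith)
      (by linarith) (by linarith) (by linarith)
  obtain ⟨R, m, J, hR, hsR, hJ, hmJ, hN, hlow⟩ :=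
    exists_le_sum_separatedDist_threeWeight hsurj hs (by rw [Fintype.card_fin]; omega) a c
  have hx : ∀ v, 0 < threeWeight s R a c v := threeWeight_pos ha (by linarith)
  have hup := hupper hμ (threeWeight s R a c)
  rw [sum_threeWeight hR hsR a c fun y => y ^ 2, hcard] at hup
  have hsep := sum_separatedDist_le_sum_dist hG hf hx
  rw [hcard, Fintype.card_fin] at hlow
  push_cast at hlow
  have hμx : μ * (a ^ 2 + 4 * c ^ 2 + (n - 5) * 1 ^ 2) =
      a * ((n - 5) + 4 * c) + (n - 5) * (a + (n - 6) + 8 * c) +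
        4 * c * (a + 2 * (n - 5) + 6 * c) := by
    rw [h₁, h₂, h₃]
    ring
  set E : ℝ := ∑ i ∈ J, ((Finset.card {v ∈ Sᶜ | f v = i} : ℝ) - 1) with hE
  have hterm : ∀ i ∈ J, 0 ≤ (Finset.card {v ∈ Sᶜ | f v = i} : ℝ) - 1 := fun i _ => by
    have : (1 : ℝ) ≤ Finset.card {v ∈ Sᶜ | f v = i} := by exact_mod_cast hN i
    linarith
  have hE0 : 0 ≤ E := Finset.sum_nonneg hterm
  have hcE : 0 ≤ (2 - c) * E := mul_nonneg (by linarith) hE0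
  have hmain : 4 * ((S.card : ℝ) - 1) * ((n - 2 * S.card - 7 / 2) - 2 * c) +
      2 * ((2 - c) * E) ≤ 0 := by
    rw [hμx] at hup
    linarith
  have hS : S.card = 1 := by
    by_contra hne
    have hs2 : (1 : ℝ) ≤ (S.card : ℝ) - 1 := by
      have : (2 : ℝ) ≤ S.card := by exact_mod_cast (by omega : 2 ≤ S.card)
      linarith
    have hpos : 0 < (n - 2 * S.card - 7 / 2 : ℝ) - 2 * c := by
      by_cases h8 : 2 * S.card + 8 ≤ n
      · have : (2 * S.card + 8 : ℝ) ≤ n := by exact_mod_cast h8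
        linarith
      · obtain ⟨h, h'⟩ | ⟨h, h'⟩ : (S.card = 3 ∧ n = 13) ∨ (S.card = 4 ∧ n = 15) := by omega
        all_goals
          rw [h'] at hcn
          rw [h, h']
          norm_num at hcn ⊢
          linarith
    linarith [mul_pos (by linarith : 0 < 4 * ((S.card : ℝ) - 1)) hpos]
  have hSR : (S.card : ℝ) = 1 := by exact_mod_cast hS
  rw [hSR] at hmain hlow
  have hEzero : E = 0 := by
    have : (2 - c) * E = 0 := by linarith
    exact (mul_eq_zero.1 this).resolve_left (by linarith)
  have hdist := dist_eq_separatedDist hG hf hx (by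
    rw [hμx] at hup
    rw [hEzero] at hlow
    linarith)
  obtain ⟨s', rfl⟩ := Finset.card_eq_one.1 hS
  refine nonempty_iso_starGraph_of_dist_eq hcard (by omega) (by rw [Fintype.card_fin, hS]) hdist
    (m := m) fun i hi => ?_
  have hJeq : J = Finset.univ.erase m := Finset.eq_of_subset_of_card_le
    (fun j hj => Finset.mem_erase.2 ⟨fun h => hmJ (h ▸ hj), Finset.mem_univ j⟩)
    (by rw [Finset.card_erase_of_mem (Finset.mem_univ m), Finset.card_univ, Fintype.card_fin, hJ,
      hS])
  have hone := (Finset.sum_eq_zero_iff_of_nonneg hterm).1 hEzero i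
    (hJeq ▸ Finset.mem_erase.2 ⟨hi, Finset.mem_univ i⟩)
  exact_mod_cast (sub_eq_zero.1 hone)

/-- **Theorem (Statement 1).** Let `G` be a connected graph of order `n ≥ 12`. If
`λ₁(D(G)) ≤ λ₁(D(G*))` where `G* = K₁ ∨ (K_{n-5} ∪ 4K₁)`, then `G` admits a
spanning `4`-tree, unless `G ≅ G*`. -/
theorem spanning_four_tree_of_distSpecRad {V : Type*} [Fintype V] [DecidableEq V]
    (n : ℕ) (hcard : Fintype.card V = n) (hn : 12 ≤ n)
    (G : SimpleGraph V) (hG : G.Connected)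
    (hspec : distSpecRad G ≤ distSpecRad (starGraph n 4)) :
    HasSpanningKTree G 4 ∨ Nonempty (G ≃g starGraph n 4) := by
  by_cases htree : HasSpanningKTree G 4
  · exact Or.inl htree
  · refine Or.inr ?_
    obtain ⟨S, hS, f, hsurj, hf⟩ := hG.exists_separator_of_forall_isTree (k := 4) (by norm_num)
      fun T hT hTtree => by
        by_contra! h
        exact htree ⟨T, hT, hTtree, h⟩
    exact nonempty_iso_starGraph_of_separator hcard hn hG hspec hS hsurj hf
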